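/- Let $s(n)$ be the number of chord diagrams of size $n$ with no simple chords. Then for all $n \geq 1$, $\frac{(2n-1)!!}{e}\left(e^{-\frac{1}{2n-1}} - \frac{10}{n}\right) \leq s(n) \leq \frac{(2n-1)!!}{e}\left(e^{-\frac{1}{2n-1}} + \frac{10}{n}\right)$. -/

import Mathlib

open MeasureTheory ProbabilityTheory Filter
open scoped Nat

instance {N : ℕ} : MeasurableSpace (Equiv.Perm (Fin N)) := ⊤

/-- A chord diagram of size `n` is a fixed-point-free involution of `{1,…,2n}`. -/
def IsChordDiagram {n : ℕ} (π : Equiv.Perm (Fin (2 * n))) : Prop :=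
  (∀ i, π (π i) = i) ∧ ∀ i, π i ≠ i

/-- The uniform probability measure on chord diagrams of size `n`. -/
noncomputable def uniformCD (n : ℕ) : Measure (Equiv.Perm (Fin (2 * n))) :=
  uniformOn {π | IsChordDiagram π}

/-- The number of crossings: quadruples `i < j < k < l` with `π i = k` and `π j = l`. -/
def crossings {n : ℕ} (π : Equiv.Perm (Fin (2 * n))) : ℕ :=
  ((Finset.univ : Finset (Fin (2 * n) × Fin (2 * n) × Fin (2 * n) × Fin (2 * n))).filter
    (fun q => q.1 < q.2.1 ∧ q.2.1 < q.2.2.1 ∧ q.2.2.1 < q.2.2.2 ∧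
      π q.1 = q.2.2.1 ∧ π q.2.1 = q.2.2.2)).card

/-- The number of simple chords: indices `k` with `π k = k + 1 (mod 2n)`. -/
def simpleChords {n : ℕ} (π : Equiv.Perm (Fin (2 * n))) : ℕ :=
  (Finset.univ.filter (fun k => π k = finRotate (2 * n) k)).card

open scoped Classical in
/-- The number of chord diagrams of size `n` with no simple chords. -/
noncomputable def simpleChordFree (n : ℕ) : ℕ :=
  ((Finset.univ : Finset (Equiv.Perm (Fin (2 * n)))).filter
    (fun π => IsChordDiagram π ∧ simpleChords π = 0)).card

/-- Fixed-point-free involutions of `Fin N`. -/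
abbrev Matching (N : ℕ) : Type :=
  {f : Fin N → Fin N // ∀ i, f (f i) = i ∧ f i ≠ i}

/-- The number of `i` that are sent to `i + 1`, without wrapping around. -/
def linearSimpleChords {N : ℕ} (f : Fin N → Fin N) : ℕ :=
  (Finset.univ.filter (fun i => (f i).val = i.val + 1)).card

/-- Add to `σ` a chord from a new leftmost point to a new point placed in the gap `j`. -/
def insertChord {N : ℕ} (σ : Fin N → Fin N) (j : Fin (N + 1)) : Fin (N + 2) → Fin (N + 2) :=
  Fin.cons (α := fun _ => Fin (N + 2)) j.succ
    (j.insertNth (α := fun _ => Fin (N + 2)) 0 (fun x => (j.succAbove (σ x)).succ))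

section insertChord

variable {N : ℕ} (σ : Fin N → Fin N) (j : Fin (N + 1))

@[simp] lemma insertChord_zero : insertChord σ j 0 = j.succ := rfl

@[simp] lemma insertChord_succ_self : insertChord σ j j.succ = 0 := by
  simp [insertChord]

@[simp] lemma insertChord_succ_succAbove (x : Fin N) :
    insertChord σ j (j.succAbove x).succ = (j.succAbove (σ x)).succ := by
  simp [insertChord]

lemma forall_fin_iff_succAbove {P : Fin (N + 2) → Prop} :
    (∀ i, P i) ↔ P 0 ∧ P j.succ ∧ ∀ x, P (j.succAbove x).succ := by
  rw [Fin.forall_fin_succ, Fin.forall_iff_succAbove j]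

lemma insertChord_involutive_iff :
    (∀ i, insertChord σ j (insertChord σ j i) = i ∧ insertChord σ j i ≠ i) ↔
      ∀ i, σ (σ i) = i ∧ σ i ≠ i := by
  rw [forall_fin_iff_succAbove j]
  simp [Fin.succ_ne_zero, (Fin.succ_ne_zero _).symm]

end insertChord

/-- `insertChord` on matchings. -/
def Matching.insert {N : ℕ} (p : Matching N × Fin (N + 1)) : Matching (N + 2) :=
  ⟨insertChord p.1.1 p.2, (insertChord_involutive_iff _ _).2 p.1.2⟩

lemma Matching.insert_bijective (N : ℕ) :
    Function.Bijective (Matching.insert : Matching N × Fin (N + 1) → Matching (N + 2)) := by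
  constructor
  · rintro ⟨⟨σ, hσ⟩, j⟩ ⟨⟨τ, hτ⟩, l⟩ h
    have h : insertChord σ j = insertChord τ l := congrArg Subtype.val h
    obtain rfl : j = l := by simpa using congrFun h 0
    obtain rfl : σ = τ := by
      ext x
      have hx := congrFun h (j.succAbove x).succ
      rw [insertChord_succ_succAbove, insertChord_succ_succAbove] at hx
      rw [Fin.succAbove_right_injective (Fin.succ_injective _ hx)]
    rfl
  · rintro ⟨f, hf⟩
    obtain ⟨j, hj⟩ := Fin.exists_succ_eq.2 (hf 0).2
    have hinj : Function.Injective f := fun a b h => by rw [← (hf a).1, h, (hf b).1]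
    have key (x : Fin N) : ∃ y, (j.succAbove y).succ = f (j.succAbove x).succ := by
      have h0 : f (j.succAbove x).succ ≠ 0 := by
        rw [← (hf 0).1, ← hj]
        intro h
        exact Fin.succAbove_ne j x (Fin.succ_injective _ (hinj h))
      obtain ⟨z, hz⟩ := Fin.exists_succ_eq.2 h0
      have hzj : z ≠ j := by
        rintro rfl
        exact Fin.succ_ne_zero _ (hinj (hz.symm.trans hj))
      obtain ⟨y, rfl⟩ := Fin.exists_succAbove_eq hzj
      exact ⟨y, hz⟩
    choose σ hσ using key
    have hins : insertChord σ j = f := by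
      refine funext ((forall_fin_iff_succAbove j).2 ⟨?_, ?_, ?_⟩)
      · simpa using hj
      · rw [insertChord_succ_self, hj, (hf 0).1]
      · intro x
        rw [insertChord_succ_succAbove, hσ]
    refine ⟨(⟨σ, (insertChord_involutive_iff σ j).1 (hins ▸ hf)⟩, j), Subtype.ext hins⟩

lemma Matching.sum_insert {N : ℕ} {R : Type*} [AddCommMonoid R] (F : Matching (N + 2) → R) :
    ∑ f, F f = ∑ σ : Matching N, ∑ j, F (Matching.insert (σ, j)) := by
  rw [← Fintype.sum_prod_type']
  exact (Fintype.sum_bijective _ (Matching.insert_bijective N) _ _ fun _ => rfl).symm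

lemma linearSimpleChords_insertChord {N : ℕ} (σ : Fin N → Fin N) (j : Fin (N + 1)) :
    linearSimpleChords (insertChord σ j) = (if j = 0 then 1 else 0) +
      ∑ x, if (j.succAbove (σ x)).val = (j.succAbove x).val + 1 then 1 else 0 := by
  rw [linearSimpleChords, Finset.card_filter, Fin.sum_univ_succ, Fin.sum_univ_succAbove _ j]
  simp only [insertChord_zero, insertChord_succ_self, insertChord_succ_succAbove, Fin.val_succ,
    Fin.val_zero, Fin.ext_iff, Nat.add_right_cancel_iff]
  simp

namespace Matching

variable {N : ℕ} (σ : Matching N)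

lemma linearSimpleChords_insert_zero :
    linearSimpleChords (insert (σ, 0)).1 = linearSimpleChords σ.1 + 1 := by
  rw [insert, linearSimpleChords_insertChord, linearSimpleChords, Finset.card_filter]
  simp [add_comm]

lemma linearSimpleChords_insert_succ (x : Fin N) :
    linearSimpleChords (insert (σ, x.succ)).1 =
      linearSimpleChords σ.1 - if (σ.1 x).val = x.val + 1 then 1 else 0 := by
  rw [insert, linearSimpleChords_insertChord, linearSimpleChords, Finset.card_filter]
  have key (y : Fin N) : (if (x.succ.succAbove (σ.1 y)).val = (x.succ.succAbove y).val + 1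
        then 1 else 0) + (if y = x then if (σ.1 x).val = x.val + 1 then 1 else 0 else 0) =
      if (σ.1 y).val = y.val + 1 then 1 else 0 := by
    have hne : (σ.1 y).val ≠ y.val := fun h => (σ.2 y).2 (Fin.ext h)
    by_cases hyx : y = x
    · subst hyx
      simp only [Fin.succAbove, Fin.lt_def, Fin.val_castSucc, Fin.val_succ]
      split_ifs <;> simp_all
    · have hyx' : y.val ≠ x.val := fun h => hyx (Fin.ext h)
      simp only [Fin.succAbove, Fin.lt_def, Fin.val_castSucc, Fin.val_succ, hyx, if_false]
      split_ifs <;> simp_all <;> omega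
  rw [← Finset.sum_congr rfl fun y _ => key y, Finset.sum_add_distrib]
  simp [Fin.succ_ne_zero]

lemma linearSimpleChords_le : linearSimpleChords σ.1 ≤ N := by
  simpa [linearSimpleChords] using Finset.card_filter_le (Finset.univ : Finset (Fin N)) _

lemma sum_choose_insert (k : ℕ) :
    ∑ j, ((linearSimpleChords (insert (σ, j)).1).choose (k + 1) : ℝ) =
      ((N : ℝ) - k) * (linearSimpleChords σ.1).choose (k + 1) +
        (linearSimpleChords σ.1).choose k := by
  rw [Fin.sum_univ_succ, linearSimpleChords_insert_zero]
  simp only [linearSimpleChords_insert_succ]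
  set L := linearSimpleChords σ.1 with hL
  have hsplit (x : Fin N) :
      ((L - if (σ.1 x).val = x.val + 1 then 1 else 0).choose (k + 1) : ℝ) =
        (L.choose (k + 1) : ℝ) + if (σ.1 x).val = x.val + 1 then
          ((L - 1).choose (k + 1) : ℝ) - L.choose (k + 1) else 0 := by
    split_ifs <;> simp
  simp only [hsplit]
  rw [Finset.sum_add_distrib, ← Finset.sum_filter, Finset.sum_const, Finset.sum_const,
    ← linearSimpleChords, ← hL, Finset.card_univ, Fintype.card_fin, nsmul_eq_mul, nsmul_eq_mul,
    Nat.choose_succ_succ]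
  have hchoose : (L : ℝ) * (L - 1).choose (k + 1) = ((L : ℝ) - (k + 1)) * L.choose (k + 1) := by
    rcases L with _ | l
    · simp
    · rcases le_or_gt k l with hkl | hkl
      · have h := Nat.choose_mul_succ_eq l (k + 1)
        have h' := congrArg (Nat.cast (R := ℝ)) h
        rw [show l + 1 - (k + 1) = l - k by omega] at h'
        push_cast [Nat.cast_sub hkl] at h' ⊢
        linear_combination h'
      · simp [Nat.choose_eq_zero_of_lt (show l < k + 1 by omega),
          Nat.choose_eq_zero_of_lt (show l + 1 < k + 1 by omega)]
  push_cast
  linear_combination hchoose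

end Matching

/-- The `k`-th binomial moment of the number of linear simple chords, not normalised. -/
noncomputable def binomialMoment (N k : ℕ) : ℝ :=
  ∑ f : Matching N, ((linearSimpleChords f.1).choose k : ℝ)

lemma binomialMoment_add_two_zero (N : ℕ) :
    binomialMoment (N + 2) 0 = (N + 1) * binomialMoment N 0 := by
  simp only [binomialMoment, Matching.sum_insert, Nat.choose_zero_right]
  simp only [Nat.cast_one, Finset.sum_const, Finset.card_univ, Fintype.card_fin, nsmul_eq_mul]
  push_cast
  ring

lemma binomialMoment_add_two_succ (N k : ℕ) :
    binomialMoment (N + 2) (k + 1) =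
      ((N : ℝ) - k) * binomialMoment N (k + 1) + binomialMoment N k := by
  simp only [binomialMoment, Matching.sum_insert, Matching.sum_choose_insert,
    Finset.sum_add_distrib, Finset.mul_sum]

lemma binomialMoment_eq_zero {N k : ℕ} (h : N < k) : binomialMoment N k = 0 :=
  Finset.sum_eq_zero fun f _ => by
    rw [Nat.choose_eq_zero_of_lt (f.linearSimpleChords_le.trans_lt h), Nat.cast_zero]

lemma binomialMoment_zero_zero : binomialMoment 0 0 = 1 := by
  have : Unique (Matching 0) := ⟨⟨⟨Fin.elim0, fun i => i.elim0⟩⟩, fun f => Subsingleton.elim _ _⟩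
  simp [binomialMoment]

lemma binomialMoment_two_mul_zero (n : ℕ) : binomialMoment (2 * n) 0 = ((2 * n - 1)‼ : ℝ) := by
  induction n with
  | zero => simpa using binomialMoment_zero_zero
  | succ n ih =>
    rw [mul_add, mul_one, binomialMoment_add_two_zero, ih]
    rcases n with _ | n
    · simp
    · rw [show 2 * (n + 1) + 2 - 1 = 2 * (n + 1) - 1 + 2 by omega, Nat.doubleFactorial_add_two,
        show 2 * (n + 1) - 1 + 2 = 2 * (n + 1) + 1 by omega]
      push_cast
      ring

/-- The number of matchings without linear simple chords. -/
def linearFree (N : ℕ) : ℕ :=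
  Fintype.card {f : Matching N // linearSimpleChords f.1 = 0}

lemma linearFree_le (n : ℕ) : (linearFree (2 * n) : ℝ) ≤ ((2 * n - 1)‼ : ℝ) := by
  rw [← binomialMoment_two_mul_zero, linearFree]
  simpa [binomialMoment] using
    Fintype.card_subtype_le fun f : Matching (2 * n) => linearSimpleChords f.1 = 0

lemma linearFree_eq_sum (N : ℕ) :
    (linearFree N : ℝ) = ∑ k ∈ Finset.range (N + 1), (-1) ^ k * binomialMoment N k := by
  simp only [binomialMoment, Finset.mul_sum]
  rw [Finset.sum_comm, linearFree, Fintype.card_subtype, Finset.card_filter, Nat.cast_sum]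
  refine Finset.sum_congr rfl fun f _ => ?_
  have h := Int.alternating_sum_range_choose (n := linearSimpleChords f.1)
  have h' := congrArg (Int.cast (R := ℝ)) h
  push_cast at h' ⊢
  rw [← h']
  refine Finset.sum_subset ?_ fun k _ hk => ?_
  · exact Finset.range_mono (Nat.succ_le_succ f.linearSimpleChords_le)
  · rw [Nat.choose_eq_zero_of_lt (by simpa using hk)]
    simp

lemma doubleFactorial_two_mul_sub_one_pos (n : ℕ) : (0 : ℝ) < ((2 * n - 1)‼ : ℝ) :=
  Nat.cast_pos.2 (Nat.doubleFactorial_pos _)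

lemma doubleFactorial_two_mul_succ_sub_one (n : ℕ) :
    ((2 * (n + 1) - 1)‼ : ℝ) = (2 * n + 1) * ((2 * n - 1)‼ : ℝ) := by
  rw [← binomialMoment_two_mul_zero, ← binomialMoment_two_mul_zero, mul_add, mul_one,
    binomialMoment_add_two_zero]
  push_cast
  ring

lemma abs_binomialMoment_div_sub_le (n k : ℕ) :
    |binomialMoment (2 * (n + 1)) k / ((2 * (n + 1) - 1)‼ : ℝ) - 1 / (k ! : ℝ)| ≤
      3 / 2 * (k * (k - 1) / (k ! : ℝ)) / (2 * n + 3) := by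
  have htail (n k : ℕ) (hk : 2 * n + 2 ≤ k)
      (h0 : binomialMoment (2 * (n + 1)) k = 0) :
      |binomialMoment (2 * (n + 1)) k / ((2 * (n + 1) - 1)‼ : ℝ) - 1 / (k ! : ℝ)| ≤
        3 / 2 * (k * (k - 1) / (k ! : ℝ)) / (2 * n + 3) := by
    have hk' : (2 * n + 2 : ℝ) ≤ k := by exact_mod_cast hk
    have hfac : (0 : ℝ) < (k ! : ℝ) := by exact_mod_cast k.factorial_pos
    have hn : (0 : ℝ) ≤ n := n.cast_nonneg
    have hu : (2 * n + 3 : ℝ) ≤ 3 / 2 * (k * (k - 1)) := by nlinarith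
    have hk1 : (0 : ℝ) ≤ k - 1 := by linarith
    rw [h0, zero_div, zero_sub, abs_neg,
      abs_of_pos (by positivity), mul_div_assoc', div_div, div_le_div_iff₀ hfac (by positivity)]
    nlinarith [mul_le_mul_of_nonneg_right hu hfac.le]
  induction n generalizing k with
  | zero =>
    rcases k with _ | _ | _ | k
    · rw [binomialMoment_two_mul_zero]; simp
    · rw [mul_add, binomialMoment_add_two_succ (2 * 0) 0,
        binomialMoment_eq_zero (k := 0 + 1) (by simp)]
      simp [binomialMoment_zero_zero]
    · rw [mul_add, binomialMoment_add_two_succ (2 * 0) 1,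
        binomialMoment_eq_zero (k := 1 + 1) (by simp), binomialMoment_eq_zero (k := 1) (by simp)]
      norm_num
    · exact htail 0 _ (by omega) (binomialMoment_eq_zero (by omega))
  | succ n ih =>
    rcases k with _ | k
    · rw [binomialMoment_two_mul_zero, div_self (doubleFactorial_two_mul_sub_one_pos _).ne']
      simp
    rcases lt_or_ge (2 * n + 3) (k + 1) with hk | hk
    · refine htail (n + 1) (k + 1) (by omega) ?_
      rw [mul_add 2 (n + 1) 1, mul_one 2, binomialMoment_add_two_succ,
        binomialMoment_eq_zero (by omega), binomialMoment_eq_zero (by omega)]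
      simp
    have hd := doubleFactorial_two_mul_sub_one_pos (n + 1)
    have hfac : (0 : ℝ) < (k ! : ℝ) := by exact_mod_cast k.factorial_pos
    rw [doubleFactorial_two_mul_succ_sub_one (n + 1), mul_add 2 (n + 1) 1, mul_one 2,
      binomialMoment_add_two_succ]
    have h1 := ih (k + 1)
    have h0 := ih k
    set d : ℝ := ((2 * (n + 1) - 1)‼ : ℝ)
    set A := binomialMoment (2 * (n + 1)) (k + 1)
    set B := binomialMoment (2 * (n + 1)) k
    have hk' : ((k : ℝ) + 1) ≤ 2 * n + 3 := by exact_mod_cast hk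
    rw [Nat.factorial_succ] at h1 ⊢
    push_cast at h1 ⊢
    obtain ⟨u, hu⟩ : ∃ u : ℝ, u = 2 * n + 3 := ⟨_, rfl⟩
    have hu3 : 3 ≤ u := by rw [hu]; linarith [n.cast_nonneg (α := ℝ)]
    have hk0 : (0 : ℝ) ≤ k := k.cast_nonneg
    have hrec : ((2 * ((n : ℝ) + 1) - k) * A + B) / ((2 * (n + 1) + 1) * d) -
        1 / ((k + 1) * (k ! : ℝ)) =
        ((u - (k + 1)) * (A / d - 1 / ((k + 1) * (k ! : ℝ))) + (B / d - 1 / (k ! : ℝ))) / u := by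
      rw [show 2 * ((n : ℝ) + 1) + 1 = u by rw [hu]; ring,
        show 2 * ((n : ℝ) + 1) - k = u - (k + 1) by rw [hu]; ring]
      have : u ≠ 0 := by positivity
      field_simp
      ring
    rw [show 2 * ((n : ℝ) + 1) + 3 = u + 2 by rw [hu]; ring]
    rw [← hu] at h0 h1 hk'
    calc _ ≤ ((u - (k + 1)) * (3 / 2 * ((k + 1) * (k + 1 - 1) / ((k + 1) * (k ! : ℝ))) / u) +
          3 / 2 * (k * (k - 1) / (k ! : ℝ)) / u) / u := by
          rw [hrec, abs_div, abs_of_pos (show 0 < u by positivity)]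
          gcongr
          refine (abs_add_le _ _).trans (add_le_add ?_ h0)
          rw [abs_mul, abs_of_nonneg (sub_nonneg.2 hk')]
          exact mul_le_mul_of_nonneg_left h1 (sub_nonneg.2 hk')
      _ = 3 / 2 * (k / (k ! : ℝ)) * ((u - 2) / u ^ 2) := by
          field_simp
          ring
      _ ≤ 3 / 2 * (k / (k ! : ℝ)) * (1 / (u + 2)) := by
          gcongr 3 / 2 * (k / (k ! : ℝ)) * ?_
          rw [div_le_div_iff₀ (by positivity) (by positivity)]
          nlinarith
      _ = _ := by
          field_simp
          ring

lemma hasSum_natCast_mul_pred_div_factorial :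
    HasSum (fun k : ℕ => (k * (k - 1) / (k ! : ℝ) : ℝ)) (Real.exp 1) := by
  rw [← hasSum_nat_add_iff' 2]
  have h := NormedSpace.expSeries_div_hasSum_exp (𝔸 := ℝ) 1
  rw [← Real.exp_eq_exp_ℝ] at h
  simp only [one_pow] at h
  have hterm (k : ℕ) : 1 / (k ! : ℝ) =
      ((k + 2 : ℕ) : ℝ) * (((k + 2 : ℕ) : ℝ) - 1) / ((k + 2)! : ℝ) := by
    rw [Nat.factorial_succ, Nat.factorial_succ]
    push_cast
    field_simp
    ring
  simp only [hterm] at h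
  simpa [Finset.sum_range_succ] using h

lemma abs_linearFree_div_sub_le (n : ℕ) :
    |(linearFree (2 * (n + 1)) : ℝ) / ((2 * (n + 1) - 1)‼ : ℝ) - Real.exp (-1)| ≤
      3 / 2 * Real.exp 1 / (2 * n + 3) := by
  have hexp := NormedSpace.expSeries_div_hasSum_exp (𝔸 := ℝ) (-1)
  rw [← Real.exp_eq_exp_ℝ] at hexp
  have hfree : HasSum (fun k => (-1) ^ k * binomialMoment (2 * (n + 1)) k /
      ((2 * (n + 1) - 1)‼ : ℝ)) ((linearFree (2 * (n + 1)) : ℝ) / ((2 * (n + 1) - 1)‼ : ℝ)) := by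
    rw [linearFree_eq_sum, Finset.sum_div]
    refine hasSum_sum_of_ne_finset_zero fun k hk => ?_
    rw [binomialMoment_eq_zero (by simpa using hk)]
    simp
  have hbound := (hasSum_natCast_mul_pred_div_factorial.mul_left (3 / 2)).div_const (2 * n + 3 : ℝ)
  rw [← (hfree.sub hexp).tsum_eq, ← Real.norm_eq_abs]
  refine tsum_of_norm_bounded hbound fun k => ?_
  refine le_trans (le_of_eq ?_) (abs_binomialMoment_div_sub_le n k)
  rw [mul_div_assoc, ← mul_one_div ((-1) ^ k) (k ! : ℝ), ← mul_sub, norm_mul, norm_pow, norm_neg,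
    norm_one, one_pow, one_mul, Real.norm_eq_abs]

/-- The number of matchings of `Fin N` without simple chords, wrapping around. -/
def circularFree (N : ℕ) : ℕ :=
  Fintype.card {f : Matching N // ∀ i, f.1 i ≠ finRotate N i}

lemma linearSimpleChords_eq_zero_iff {N : ℕ} (f : Fin N → Fin N) :
    linearSimpleChords f = 0 ↔ ∀ i, (f i).val ≠ i.val + 1 := by
  simp [linearSimpleChords, Finset.filter_eq_empty_iff]

lemma Matching.forall_ne_finRotate_iff {N : ℕ} (f : Matching (N + 1)) :
    (∀ i, f.1 i ≠ finRotate (N + 1) i) ↔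
      linearSimpleChords f.1 = 0 ∧ f.1 0 ≠ Fin.last N := by
  have hlast : f.1 0 = Fin.last N ↔ f.1 (Fin.last N) = 0 :=
    ⟨fun h => h ▸ (f.2 0).1, fun h => h ▸ (f.2 (Fin.last N)).1⟩
  rw [linearSimpleChords_eq_zero_iff, ne_eq, hlast, Fin.forall_fin_succ', Fin.forall_fin_succ']
  have hle := (f.1 (Fin.last N)).is_lt
  have hrot (i : Fin N) : (finRotate (N + 1) i.castSucc).val = i.val + 1 := by
    simp
  simp only [finRotate_last, Fin.val_castSucc, Fin.val_last, hrot, ne_eq, Fin.ext_iff, hle.ne,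
    not_false_eq_true, and_true, Fin.val_zero]

lemma circularFree_add_linearFree (N : ℕ) :
    circularFree (N + 3) + linearFree (N + 1) = linearFree (N + 3) := by
  have hcirc : circularFree (N + 3) = Fintype.card {f : Matching (N + 3) //
      linearSimpleChords f.1 = 0 ∧ f.1 0 ≠ Fin.last (N + 2)} :=
    Fintype.card_congr (Equiv.subtypeEquivRight fun f => f.forall_ne_finRotate_iff)
  have hlin : linearFree (N + 1) = Fintype.card {f : Matching (N + 3) //
      linearSimpleChords f.1 = 0 ∧ f.1 0 = Fin.last (N + 2)} := by
    rw [linearFree, Fintype.card_subtype, Fintype.card_subtype, Finset.card_filter,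
      Finset.card_filter, Matching.sum_insert]
    refine Finset.sum_congr rfl fun σ _ => ?_
    rw [Fintype.sum_eq_single (Fin.last (N + 1))]
    · have hσ : (σ.1 (Fin.last N)).val ≠ N + 1 := (σ.1 (Fin.last N)).is_lt.ne
      rw [← Fin.succ_last N, σ.linearSimpleChords_insert_succ]
      simp [Matching.insert, hσ]
    · intro j hj
      refine if_neg fun h => hj (Fin.succ_injective _ ?_)
      simpa [Matching.insert] using h.2
  rw [hcirc, hlin, linearFree, add_comm, Fintype.card_subtype, Fintype.card_subtype,
    Fintype.card_subtype]
  simp only [← Finset.filter_filter]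
  exact Finset.card_filter_add_card_filter_not _

lemma simpleChordFree_eq_circularFree (n : ℕ) : simpleChordFree n = circularFree (2 * n) := by
  classical
  rw [simpleChordFree, circularFree, ← Fintype.card_subtype]
  refine Fintype.card_congr
    { toFun := fun π => ⟨⟨π.1, fun i => ⟨π.2.1.1 i, π.2.1.2 i⟩⟩, ?_⟩
      invFun := fun f => ⟨⟨f.1.1, f.1.1, fun i => (f.1.2 i).1, fun i => (f.1.2 i).1⟩,
        ⟨fun i => (f.1.2 i).1, fun i => (f.1.2 i).2⟩, ?_⟩
      left_inv := fun π => Subtype.ext (Equiv.ext fun _ => rfl)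
      right_inv := fun f => rfl }
  · simpa [simpleChords, Finset.filter_eq_empty_iff] using π.2.2
  · simpa [simpleChords, Finset.filter_eq_empty_iff] using f.2

lemma simpleChordFree_one : simpleChordFree 1 = 0 := by
  rw [simpleChordFree_eq_circularFree]
  decide

/-- Theorem 3: explicit bounds on the number `s(n)` of chord diagrams with no simple chords. -/
theorem simpleChordFree_bounds (n : ℕ) (hn : 1 ≤ n) :
    ((2 * n - 1)‼ : ℝ) / Real.exp 1 * (Real.exp (-(1 / (2 * (n : ℝ) - 1))) - 10 / n)
        ≤ (simpleChordFree n : ℝ) ∧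
    (simpleChordFree n : ℝ)
        ≤ ((2 * n - 1)‼ : ℝ) / Real.exp 1 * (Real.exp (-(1 / (2 * (n : ℝ) - 1))) + 10 / n) := by
  have hD := doubleFactorial_two_mul_sub_one_pos n
  have hc := Real.exp_pos 1
  suffices h : |(simpleChordFree n : ℝ) * Real.exp 1 / ((2 * n - 1)‼ : ℝ) -
      Real.exp (-(1 / (2 * (n : ℝ) - 1)))| ≤ 10 / n by
    obtain ⟨hlow, hupp⟩ := abs_le.1 h
    constructor
    · rw [div_mul_eq_mul_div, div_le_iff₀ hc, mul_comm, ← le_div_iff₀ hD]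
      linarith
    · rw [div_mul_eq_mul_div, le_div_iff₀ hc, mul_comm _ (_ + _), ← div_le_iff₀ hD]
      linarith
  obtain ⟨n, rfl⟩ := Nat.exists_eq_add_of_le' hn
  rcases n with _ | m
  · rw [simpleChordFree_one, Nat.cast_zero, zero_mul, zero_div, zero_sub, abs_neg, Real.abs_exp]
    exact (Real.exp_le_one_iff.2 (by norm_num)).trans (by norm_num)
  have hs : (simpleChordFree (m + 1 + 1) : ℝ) =
      linearFree (2 * (m + 1 + 1)) - linearFree (2 * (m + 1)) := by
    rw [eq_sub_iff_add_eq, simpleChordFree_eq_circularFree]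
    exact_mod_cast circularFree_add_linearFree (2 * m + 1)
  have ha := abs_linearFree_div_sub_le (m + 1)
  have hb : (linearFree (2 * (m + 1)) : ℝ) / ((2 * (m + 1 + 1) - 1)‼ : ℝ) ≤ 1 / (2 * m + 3) := by
    have hD' := doubleFactorial_two_mul_sub_one_pos (m + 1)
    rw [div_le_div_iff₀ hD (by positivity), doubleFactorial_two_mul_succ_sub_one (m + 1)]
    push_cast
    nlinarith [linearFree_le (m + 1)]
  have hb0 : 0 ≤ (linearFree (2 * (m + 1)) : ℝ) / ((2 * (m + 1 + 1) - 1)‼ : ℝ) := by positivity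
  rw [hs, sub_mul, sub_div, mul_div_right_comm, mul_div_right_comm]
  set a := (linearFree (2 * (m + 1 + 1)) : ℝ) / ((2 * (m + 1 + 1) - 1)‼ : ℝ)
  set b := (linearFree (2 * (m + 1)) : ℝ) / ((2 * (m + 1 + 1) - 1)‼ : ℝ)
  push_cast at ha ⊢
  rw [show 2 * ((m : ℝ) + 1 + 1) - 1 = 2 * m + 3 by ring]
  rw [show 2 * ((m : ℝ) + 1) + 3 = 2 * m + 5 by ring] at ha
  have hE1 : Real.exp (-(1 / (2 * (m : ℝ) + 3))) ≤ 1 :=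
    Real.exp_le_one_iff.2 (neg_nonpos.2 (by positivity))
  have hE0 := Real.add_one_le_exp (-(1 / (2 * (m : ℝ) + 3)))
  set E := Real.exp (-(1 / (2 * (m : ℝ) + 3)))
  have hexp : Real.exp (-1) * Real.exp 1 = 1 := by rw [← Real.exp_add]; simp
  have hc3 : Real.exp 1 < 2.72 := Real.exp_one_lt_d9.trans (by norm_num)
  have hc2 : 1 ≤ Real.exp 1 := Real.one_le_exp zero_le_one
  have hae : |a * Real.exp 1 - 1| ≤ 12 / (2 * m + 5) := by
    rw [show a * Real.exp 1 - 1 = (a - Real.exp (-1)) * Real.exp 1 by rw [sub_mul, hexp], abs_mul,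
      Real.abs_exp]
    calc _ ≤ 3 / 2 * Real.exp 1 / (2 * m + 5) * Real.exp 1 := by gcongr
      _ = 3 / 2 * Real.exp 1 * Real.exp 1 / (2 * m + 5) := by ring
      _ ≤ _ := by
        gcongr
        nlinarith
  have hbe : b * Real.exp 1 ≤ 2.72 * (1 / (2 * m + 3)) := by
    rw [mul_comm]
    gcongr
  have hbe0 : 0 ≤ b * Real.exp 1 := by positivity
  have hfinal : 12 / (2 * (m : ℝ) + 5) + 2.72 * (1 / (2 * m + 3)) ≤ 10 / ((m : ℝ) + 1 + 1) := by
    have h5 : 12 / (2 * (m : ℝ) + 5) ≤ 6 / ((m : ℝ) + 1 + 1) := by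
      rw [div_le_div_iff₀ (by positivity) (by positivity)]
      linarith
    have h3 : 1 / (2 * (m : ℝ) + 3) ≤ 1 / ((m : ℝ) + 1 + 1) := by
      apply one_div_le_one_div_of_le (by positivity)
      linarith [m.cast_nonneg (α := ℝ)]
    have hsum : 10 / ((m : ℝ) + 1 + 1) = 6 / ((m : ℝ) + 1 + 1) + 4 * (1 / ((m : ℝ) + 1 + 1)) := by
      ring
    have hpos : 0 ≤ 1 / ((m : ℝ) + 1 + 1) := by positivity
    linarith
  have hx : 0 ≤ 1 / (2 * (m : ℝ) + 3) := by positivity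
  obtain ⟨hae1, hae2⟩ := abs_le.1 hae
  exact abs_le.2 ⟨by linarith, by linarith⟩
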